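/- Let K be an n×n complex positive definite matrix. Then the function f(X) = log det(I + K X⁻¹) is strictly convex on the cone of n×n complex positive definite matrices; that is, for all positive definite X ≠ Y and all λ ∈ (0,1), one has f(λX + (1−λ)Y) < λ f(X) + (1−λ) f(Y). -/

import Mathlib

open Matrix
open scoped ComplexOrder

namespace Matrix

variable {ι : Type*} [Fintype ι] [DecidableEq ι]

/-- The Hermitian matrix congruent via `T` to the real diagonal matrix with entries `d`. -/
noncomputable def diagCongr (T : Matrix ι ι ℂ) (d : ι → ℝ) : Matrix ι ι ℂ :=
  star T * diagonal (fun i ↦ (d i : ℂ)) * T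

lemma smul_diagCongr_add_smul (T : Matrix ι ι ℂ) (a b : ℝ) (d e : ι → ℝ) :
    (a : ℂ) • diagCongr T d + (b : ℂ) • diagCongr T e =
      diagCongr T (fun i ↦ a * d i + b * e i) := by
  have h : diagonal (fun i ↦ ((a * d i + b * e i : ℝ) : ℂ)) =
      (a : ℂ) • diagonal (fun i ↦ (d i : ℂ)) + (b : ℂ) • diagonal (fun i ↦ (e i : ℂ)) := by
    ext i j
    by_cases hij : i = j <;> simp [diagonal, hij]
  simp only [diagCongr, h, Matrix.mul_add, Matrix.add_mul, Matrix.mul_smul, Matrix.smul_mul]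

lemma posSemidef_diagCongr_iff {T : Matrix ι ι ℂ} (hT : IsUnit T) {d : ι → ℝ} :
    (diagCongr T d).PosSemidef ↔ ∀ i, 0 ≤ d i := by
  simp [diagCongr, IsUnit.posSemidef_star_left_conjugate_iff hT]

lemma posDef_diagCongr_iff {T : Matrix ι ι ℂ} (hT : IsUnit T) {d : ι → ℝ} :
    (diagCongr T d).PosDef ↔ ∀ i, 0 < d i := by
  simp [diagCongr, IsUnit.posDef_star_left_conjugate_iff hT]

lemma det_diagCongr_re (T : Matrix ι ι ℂ) (d : ι → ℝ) :
    (diagCongr T d).det.re = Complex.normSq T.det * ∏ i, d i := by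
  have h : (diagCongr T d).det = ((Complex.normSq T.det * ∏ i, d i : ℝ) : ℂ) := by
    rw [diagCongr, det_mul, det_mul, star_eq_conjTranspose, det_conjTranspose, det_diagonal]
    push_cast
    rw [Complex.normSq_eq_conj_mul_self, starRingEnd_apply]
    ring
  rw [h, Complex.ofReal_re]

lemma inv_diagCongr (T : Matrix ι ι ℂ) {d : ι → ℝ} (hd : ∀ i, d i ≠ 0) :
    (diagCongr T d)⁻¹ = diagCongr (star T⁻¹) (fun i ↦ (d i)⁻¹) := by
  have h : (diagonal (fun i ↦ (d i : ℂ)))⁻¹ = diagonal (fun i ↦ (((d i)⁻¹ : ℝ) : ℂ)) := by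
    refine inv_eq_right_inv ?_
    rw [diagonal_mul_diagonal, ← diagonal_one]
    congr 1
    ext i
    have := hd i
    simp [this]
  rw [diagCongr, diagCongr, mul_inv_rev, mul_inv_rev, h, star_star, star_eq_conjTranspose,
    star_eq_conjTranspose, conjTranspose_nonsing_inv, Matrix.mul_assoc]

/-- A positive definite and a Hermitian matrix are simultaneously diagonalized by a congruence. -/
lemma PosDef.exists_diagCongr {A B : Matrix ι ι ℂ} (hA : A.PosDef) (hB : B.IsHermitian) :
    ∃ (T : Matrix ι ι ℂ) (d : ι → ℝ), IsUnit T ∧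
      A = diagCongr T (fun _ ↦ 1) ∧ B = diagCongr T d := by
  obtain ⟨S, hS, hAS⟩ : ∃ S : Matrix ι ι ℂ, IsUnit S ∧ A = star S * S := by
    open scoped MatrixOrder Matrix.Norms.L2Operator in
    exact CStarAlgebra.isStrictlyPositive_iff_eq_star_mul_self.mp
      (isStrictlyPositive_iff_posDef.mpr hA)
  have hS' := (isUnit_iff_isUnit_det S).mp hS
  have hC : (star S⁻¹ * B * S⁻¹).IsHermitian := isHermitian_conjTranspose_mul_mul _ hB
  have hU : (hC.eigenvectorUnitary : Matrix ι ι ℂ) * star (hC.eigenvectorUnitary : Matrix ι ι ℂ)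
      = 1 := Unitary.coe_mul_star_self _
  have hCU := hC.spectral_theorem
  rw [Unitary.conjStarAlgAut_apply] at hCU
  generalize (hC.eigenvectorUnitary : Matrix ι ι ℂ) = U at hU hCU
  generalize hC.eigenvalues = d at hCU
  have hSS : star S * star S⁻¹ = 1 := by
    rw [← star_mul, nonsing_inv_mul _ hS', star_one]
  refine ⟨star U * S, d, ?_, ?_, ?_⟩
  · exact (IsUnit.of_mul_eq_one _ (mul_eq_one_comm.mp hU)).mul hS
  · simp only [diagCongr, Complex.ofReal_one, diagonal_one, Matrix.mul_one, star_mul, star_star]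
    rw [hAS, Matrix.mul_assoc, ← Matrix.mul_assoc U, hU, Matrix.one_mul]
  · calc B = star S * star S⁻¹ * B * (S⁻¹ * S) := by
            rw [hSS, nonsing_inv_mul _ hS', Matrix.one_mul, Matrix.mul_one]
      _ = star S * (star S⁻¹ * B * S⁻¹) * S := by simp only [Matrix.mul_assoc]
      _ = _ := by
        rw [hCU, diagCongr, star_mul, star_star]
        simp only [Matrix.mul_assoc]
        rfl

lemma PosDef.det_re_pos {A : Matrix ι ι ℂ} (hA : A.PosDef) : 0 < A.det.re :=
  (Complex.pos_iff.mp hA.det_pos).1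

lemma PosDef.ofReal_det_re {A : Matrix ι ι ℂ} (hA : A.PosDef) : (A.det.re : ℂ) = A.det :=
  Complex.ext rfl (Complex.pos_iff.mp hA.det_pos).2

lemma PosDef.ofReal_smul {κ : Type*} {A : Matrix κ κ ℂ} (hA : A.PosDef) {a : ℝ} (ha : 0 < a) :
    ((a : ℂ) • A).PosDef :=
  hA.smul (Complex.zero_lt_real.mpr ha)

lemma PosDef.log_det_re_le {A B : Matrix ι ι ℂ} (hA : A.PosDef) (hAB : (B - A).PosSemidef) :
    Real.log A.det.re ≤ Real.log B.det.re := by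
  refine Real.log_le_log hA.det_re_pos ?_
  obtain ⟨T, d, hT, hTA, hTd⟩ := hA.exists_diagCongr hAB.1
  have hd := (posSemidef_diagCongr_iff hT).mp (hTd ▸ hAB)
  have hB : B = diagCongr T (fun i ↦ 1 * 1 + 1 * d i) := by
    rw [← smul_diagCongr_add_smul, ← hTA, ← hTd]
    simp
  rw [hB, hTA, det_diagCongr_re, det_diagCongr_re]
  refine mul_le_mul_of_nonneg_left (Finset.prod_le_prod (by simp) fun i _ ↦ ?_)
    (Complex.normSq_nonneg _)
  linarith [hd i]

/-- `log det` is strictly concave on positive definite matrices. -/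
lemma PosDef.log_det_strictConcave {A B : Matrix ι ι ℂ} (hA : A.PosDef) (hB : B.PosDef)
    (hAB : A ≠ B) {a b : ℝ} (ha : 0 < a) (hb : 0 < b) (hab : a + b = 1) :
    a * Real.log A.det.re + b * Real.log B.det.re <
      Real.log ((a : ℂ) • A + (b : ℂ) • B).det.re := by
  obtain ⟨T, d, hT, rfl, rfl⟩ := hA.exists_diagCongr hB.1
  have hd := (posDef_diagCongr_iff hT).mp hB
  have hc : 0 < Complex.normSq T.det :=
    Complex.normSq_pos.mpr ((isUnit_iff_isUnit_det T).mp hT).ne_zero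
  have hlog {e : ι → ℝ} (he : ∀ i, 0 < e i) : Real.log (diagCongr T e).det.re =
      Real.log (Complex.normSq T.det) + ∑ i, Real.log (e i) := by
    rw [det_diagCongr_re, Real.log_mul hc.ne' (Finset.prod_pos fun i _ ↦ he i).ne',
      Real.log_prod fun i _ ↦ (he i).ne']
  have hne : ∃ i, 1 ≠ d i := by
    by_contra! h
    exact hAB (congrArg (diagCongr T) (funext h))
  obtain ⟨j, hj⟩ := hne
  have hsum : ∑ i, b * Real.log (d i) < ∑ i, Real.log (a * 1 + b * d i) := by
    refine Finset.sum_lt_sum (fun i _ ↦ ?_) ⟨j, Finset.mem_univ j, ?_⟩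
    · simpa using strictConcaveOn_log_Ioi.concaveOn.2 (Set.mem_Ioi.mpr one_pos)
        (Set.mem_Ioi.mpr (hd i)) ha.le hb.le hab
    · simpa using strictConcaveOn_log_Ioi.2 (Set.mem_Ioi.mpr one_pos)
        (Set.mem_Ioi.mpr (hd j)) hj ha hb hab
  rw [← Finset.mul_sum] at hsum
  rw [smul_diagCongr_add_smul, hlog (fun _ ↦ one_pos), hlog hd,
    hlog (fun i ↦ by have := mul_pos hb (hd i); linarith)]
  simp only [Real.log_one, Finset.sum_const_zero]
  linear_combination hsum + Real.log (Complex.normSq T.det) * hab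

/-- Inversion is operator convex on positive definite matrices. -/
lemma PosDef.inv_convex {A B : Matrix ι ι ℂ} (hA : A.PosDef) (hB : B.PosDef)
    {a b : ℝ} (ha : 0 < a) (hb : 0 < b) (hab : a + b = 1) :
    ((a : ℂ) • A⁻¹ + (b : ℂ) • B⁻¹ - ((a : ℂ) • A + (b : ℂ) • B)⁻¹).PosSemidef := by
  obtain ⟨T, d, hT, rfl, rfl⟩ := hA.exists_diagCongr hB.1
  have hd := (posDef_diagCongr_iff hT).mp hB
  have hpos (i : ι) : 0 < a * 1 + b * d i := by have := mul_pos hb (hd i); linarith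
  have hT' : IsUnit (star T⁻¹) := ((isUnit_nonsing_inv_iff).mpr hT).star
  rw [smul_diagCongr_add_smul, inv_diagCongr T (fun _ ↦ one_ne_zero),
    inv_diagCongr T (fun i ↦ (hd i).ne'), inv_diagCongr T (fun i ↦ (hpos i).ne'),
    smul_diagCongr_add_smul, sub_eq_add_neg]
  have h := smul_diagCongr_add_smul (star T⁻¹) 1 (-1) (fun i ↦ a * 1⁻¹ + b * (d i)⁻¹)
    (fun i ↦ (a * 1 + b * d i)⁻¹)
  simp only [Complex.ofReal_one, one_smul, Complex.ofReal_neg, neg_smul] at h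
  rw [h, posSemidef_diagCongr_iff hT']
  intro i
  have hconv : (a * 1 + b * d i)⁻¹ ≤ a * 1⁻¹ + b * (d i)⁻¹ := by
    simp only [← _root_.zpow_neg_one]
    exact (convexOn_zpow (-1)).2 (Set.mem_Ioi.mpr one_pos) (Set.mem_Ioi.mpr (hd i)) ha.le hb.le hab
  linarith

lemma PosDef.inv_inv_add_inv {K X : Matrix ι ι ℂ} (hK : K.PosDef) (hX : X.PosDef) :
    (K⁻¹ + X⁻¹)⁻¹ = X * (K + X)⁻¹ * K := by
  rw [inv_add_inv (iff_of_true hK.isUnit hX.isUnit), mul_inv_rev, mul_inv_rev,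
    nonsing_inv_nonsing_inv _ ((isUnit_iff_isUnit_det _).mp hK.isUnit),
    nonsing_inv_nonsing_inv _ ((isUnit_iff_isUnit_det _).mp hX.isUnit), Matrix.mul_assoc]

lemma PosDef.inv_inv_add_inv_eq_sub {K X : Matrix ι ι ℂ} (hK : K.PosDef) (hX : X.PosDef) :
    (K⁻¹ + X⁻¹)⁻¹ = K - K * (K + X)⁻¹ * K := by
  have h : (K + X) * (K + X)⁻¹ = 1 :=
    mul_nonsing_inv _ ((isUnit_iff_isUnit_det _).mp (hK.add hX).isUnit)
  rw [Matrix.add_mul] at h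
  rw [hK.inv_inv_add_inv hX, eq_sub_iff_add_eq, ← Matrix.add_mul, add_comm, h, Matrix.one_mul]

/-- The parallel sum is operator concave on positive definite matrices. -/
lemma PosDef.inv_inv_add_inv_concave {K X Y : Matrix ι ι ℂ} (hK : K.PosDef) (hX : X.PosDef)
    (hY : Y.PosDef) {a b : ℝ} (ha : 0 < a) (hb : 0 < b) (hab : a + b = 1) :
    ((K⁻¹ + ((a : ℂ) • X + (b : ℂ) • Y)⁻¹)⁻¹ -
      ((a : ℂ) • (K⁻¹ + X⁻¹)⁻¹ + (b : ℂ) • (K⁻¹ + Y⁻¹)⁻¹)).PosSemidef := by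
  have habC : (a : ℂ) + b = 1 := by exact_mod_cast hab
  have hKab : (a : ℂ) • K + (b : ℂ) • K = K := by rw [← add_smul, habC, one_smul]
  have hZ : K + ((a : ℂ) • X + (b : ℂ) • Y) = (a : ℂ) • (K + X) + (b : ℂ) • (K + Y) := by
    rw [smul_add, smul_add, add_add_add_comm, hKab]
  rw [hK.inv_inv_add_inv_eq_sub ((hX.ofReal_smul ha).add (hY.ofReal_smul hb)),
    hK.inv_inv_add_inv_eq_sub hX, hK.inv_inv_add_inv_eq_sub hY, hZ]
  convert! ((hK.add hX).inv_convex (hK.add hY) ha hb hab).conjTranspose_mul_mul_same K using 1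
  rw [hK.1.eq]
  simp only [Matrix.mul_sub, Matrix.sub_mul, Matrix.mul_add, Matrix.add_mul, Matrix.mul_smul,
    Matrix.smul_mul, smul_sub]
  nth_rewrite 1 [← hKab]
  abel

lemma PosDef.log_det_one_add_mul_inv {K X : Matrix ι ι ℂ} (hK : K.PosDef) (hX : X.PosDef) :
    Real.log (1 + K * X⁻¹).det.re =
      Real.log K.det.re - Real.log ((K⁻¹ + X⁻¹)⁻¹).det.re := by
  have hM := (hK.inv.add hX.inv).inv
  have hMu : IsUnit (K⁻¹ + X⁻¹).det := (isUnit_iff_isUnit_det _).mp (hK.inv.add hX.inv).isUnit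
  have h : (1 + K * X⁻¹) * (K⁻¹ + X⁻¹)⁻¹ = K := by
    have hKX : 1 + K * X⁻¹ = K * (K⁻¹ + X⁻¹) := by
      rw [Matrix.mul_add, mul_nonsing_inv _ ((isUnit_iff_isUnit_det _).mp hK.isUnit)]
    rw [hKX, Matrix.mul_assoc, mul_nonsing_inv _ hMu, Matrix.mul_one]
  have hdet := congrArg (fun A ↦ (det A).re) h
  simp only [det_mul] at hdet
  rw [← hM.ofReal_det_re, Complex.re_mul_ofReal] at hdet
  have hne : (1 + K * X⁻¹).det.re ≠ 0 := by
    intro h0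
    rw [h0, zero_mul] at hdet
    exact hK.det_re_pos.ne hdet
  rw [← hdet, Real.log_mul hne hM.det_re_pos.ne', add_sub_cancel_right]

end Matrix

/-- For a positive definite `K`, the function `X ↦ log det (I + K X⁻¹)` is strictly convex
on the cone of positive definite complex matrices. -/
theorem logDet_one_add_mul_inv_strictConvexOn
    (n : ℕ) (K : Matrix (Fin n) (Fin n) ℂ) (hK : K.PosDef)
    (X Y : Matrix (Fin n) (Fin n) ℂ) (hX : X.PosDef) (hY : Y.PosDef) (hXY : X ≠ Y)
    (lam : ℝ) (hlam0 : 0 < lam) (hlam1 : lam < 1) :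
    Real.log ((1 + K * ((lam : ℂ) • X + ((1 - lam : ℝ) : ℂ) • Y)⁻¹).det.re) <
      lam * Real.log ((1 + K * X⁻¹).det.re)
        + (1 - lam) * Real.log ((1 + K * Y⁻¹).det.re) := by
  have hmu : 0 < 1 - lam := sub_pos.mpr hlam1
  have hab : lam + (1 - lam) = 1 := add_sub_cancel _ _
  have hMX := (hK.inv.add hX.inv).inv
  have hMY := (hK.inv.add hY.inv).inv
  have hinv {A B : Matrix (Fin n) (Fin n) ℂ} (hA : A.PosDef) (h : A⁻¹ = B⁻¹) : A = B :=
    inv_inj h ((isUnit_iff_isUnit_det _).mp hA.isUnit)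
  have hne : (K⁻¹ + X⁻¹)⁻¹ ≠ (K⁻¹ + Y⁻¹)⁻¹ := fun h ↦
    hXY (hinv hX (add_left_cancel (hinv (hK.inv.add hX.inv) h)))
  have hconc := hMX.log_det_strictConcave hMY hne hlam0 hmu hab
  have hmono := ((hMX.ofReal_smul hlam0).add (hMY.ofReal_smul hmu)).log_det_re_le
    (hK.inv_inv_add_inv_concave hX hY hlam0 hmu hab)
  rw [hK.log_det_one_add_mul_inv hX, hK.log_det_one_add_mul_inv hY,
    hK.log_det_one_add_mul_inv ((hX.ofReal_smul hlam0).add (hY.ofReal_smul hmu))]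
  linarith
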